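/- Characterization of supersolutions (Theorem 4.1, supersolution part). Let U ⊆ ℝⁿ (n ≥ 1) be a bounded open set and let (u₁, u₂) be a pair of continuous real functions on the closure of U. Then (u₁, u₂) is a viscosity supersolution of the system −Δ∞u₁ + u₁ − u₂ = 0, −Δ∞u₂ + u₂ − u₁ = 0 in U if and only if (u₁, u₂) enjoys comparison with generalized cones from below in U. -/

import Mathlib

open Filter Metric Set Topology

noncomputable def secondDeriv {n : ℕ} (φ : EuclideanSpace ℝ (Fin n) → ℝ)
    (x v : EuclideanSpace ℝ (Fin n)) : ℝ :=
  iteratedFDeriv ℝ 2 φ x ![v, v]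

open scoped Classical in
noncomputable def laplInfPlus {n : ℕ} (φ : EuclideanSpace ℝ (Fin n) → ℝ)
    (x : EuclideanSpace ℝ (Fin n)) : ℝ :=
  if gradient φ x = 0 then
    sSup {t : ℝ | ∃ v : EuclideanSpace ℝ (Fin n), ‖v‖ = 1 ∧ t = secondDeriv φ x v}
  else secondDeriv φ x (gradient φ x) / ‖gradient φ x‖ ^ 2

open scoped Classical in
noncomputable def laplInfMinus {n : ℕ} (φ : EuclideanSpace ℝ (Fin n) → ℝ)
    (x : EuclideanSpace ℝ (Fin n)) : ℝ :=
  if gradient φ x = 0 then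
    sInf {t : ℝ | ∃ v : EuclideanSpace ℝ (Fin n), ‖v‖ = 1 ∧ t = secondDeriv φ x v}
  else secondDeriv φ x (gradient φ x) / ‖gradient φ x‖ ^ 2

/-- One half of the subsolution condition: `-Δ∞⁺φ(x₀) + u(x₀) - v(x₀) ≤ 0` at
local maximum points of `u - φ`. -/
def SubPair {n : ℕ} (U : Set (EuclideanSpace ℝ (Fin n)))
    (u v : EuclideanSpace ℝ (Fin n) → ℝ) : Prop :=
  ∀ φ : EuclideanSpace ℝ (Fin n) → ℝ, ContDiff ℝ 2 φ →
    ∀ x₀ ∈ U, IsLocalMaxOn (fun x => u x - φ x) U x₀ →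
      -laplInfPlus φ x₀ + u x₀ - v x₀ ≤ 0

def SuperPair {n : ℕ} (U : Set (EuclideanSpace ℝ (Fin n)))
    (u v : EuclideanSpace ℝ (Fin n) → ℝ) : Prop :=
  ∀ φ : EuclideanSpace ℝ (Fin n) → ℝ, ContDiff ℝ 2 φ →
    ∀ x₀ ∈ U, IsLocalMinOn (fun x => u x - φ x) U x₀ →
      0 ≤ -laplInfMinus φ x₀ + u x₀ - v x₀

/-- `(u₁, u₂)` is a viscosity subsolution of the system
`-Δ∞u₁ + u₁ - u₂ = 0`, `-Δ∞u₂ + u₂ - u₁ = 0` in `U`. -/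
def IsSubsolution {n : ℕ} (U : Set (EuclideanSpace ℝ (Fin n)))
    (u₁ u₂ : EuclideanSpace ℝ (Fin n) → ℝ) : Prop :=
  UpperSemicontinuousOn u₁ U ∧ UpperSemicontinuousOn u₂ U ∧
    SubPair U u₁ u₂ ∧ SubPair U u₂ u₁

/-- `(u₁, u₂)` is a viscosity supersolution of the system
`-Δ∞u₁ + u₁ - u₂ = 0`, `-Δ∞u₂ + u₂ - u₁ = 0` in `U`. -/
def IsSupersolution {n : ℕ} (U : Set (EuclideanSpace ℝ (Fin n)))
    (u₁ u₂ : EuclideanSpace ℝ (Fin n) → ℝ) : Prop :=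
  LowerSemicontinuousOn u₁ U ∧ LowerSemicontinuousOn u₂ U ∧
    SuperPair U u₁ u₂ ∧ SuperPair U u₂ u₁

def IsSolution {n : ℕ} (U : Set (EuclideanSpace ℝ (Fin n)))
    (u₁ u₂ : EuclideanSpace ℝ (Fin n) → ℝ) : Prop :=
  IsSubsolution U u₁ u₂ ∧ IsSupersolution U u₁ u₂

/-- First component of the generalized cone pair with vertex `x₀`. -/
noncomputable def cone₁ {n : ℕ} (x₀ : EuclideanSpace ℝ (Fin n)) (C₁ C₂ a b : ℝ)
    (x : EuclideanSpace ℝ (Fin n)) : ℝ :=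
  C₁ * Real.exp (Real.sqrt 2 * ‖x - x₀‖) + C₂ * Real.exp (-(Real.sqrt 2 * ‖x - x₀‖)) +
    a * ‖x - x₀‖ + b

/-- Second component of the generalized cone pair with vertex `x₀`. -/
noncomputable def cone₂ {n : ℕ} (x₀ : EuclideanSpace ℝ (Fin n)) (C₁ C₂ a b : ℝ)
    (x : EuclideanSpace ℝ (Fin n)) : ℝ :=
  -C₁ * Real.exp (Real.sqrt 2 * ‖x - x₀‖) - C₂ * Real.exp (-(Real.sqrt 2 * ‖x - x₀‖)) +
    a * ‖x - x₀‖ + b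

noncomputable def sphMax {n : ℕ} (u : EuclideanSpace ℝ (Fin n) → ℝ)
    (x₀ : EuclideanSpace ℝ (Fin n)) (r : ℝ) : ℝ :=
  sSup (u '' sphere x₀ r)

noncomputable def sphMin {n : ℕ} (u : EuclideanSpace ℝ (Fin n) → ℝ)
    (x₀ : EuclideanSpace ℝ (Fin n)) (r : ℝ) : ℝ :=
  sInf (u '' sphere x₀ r)

noncomputable def Splus {n : ℕ} (u : EuclideanSpace ℝ (Fin n) → ℝ)
    (x₀ : EuclideanSpace ℝ (Fin n)) (r : ℝ) : ℝ :=
  (sphMax u x₀ r - u x₀) / r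

noncomputable def Sminus {n : ℕ} (u : EuclideanSpace ℝ (Fin n) → ℝ)
    (x₀ : EuclideanSpace ℝ (Fin n)) (r : ℝ) : ℝ :=
  (sphMin u x₀ r - u x₀) / r


/-- `(u₁, u₂)` enjoys comparison with generalized cones from below in `U`. -/
def ComparisonBelow {n : ℕ} (U : Set (EuclideanSpace ℝ (Fin n))) (u₁ u₂ : EuclideanSpace ℝ (Fin n) → ℝ) : Prop :=
  ∀ x₀ ∈ U, ∀ r : ℝ, 0 < r → closedBall x₀ r ⊆ U →
    ∀ C₁ C₂ a b : ℝ,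
      (∀ x ∈ sphere x₀ r ∪ {x₀},
        cone₁ x₀ C₁ C₂ a b x ≤ u₁ x ∧ cone₂ x₀ C₁ C₂ a b x ≤ u₂ x) →
      ∀ x ∈ closedBall x₀ r,
        cone₁ x₀ C₁ C₂ a b x ≤ u₁ x ∧ cone₂ x₀ C₁ C₂ a b x ≤ u₂ x

open scoped RealInnerProductSpace

theorem eventually_norm_le_mul_norm_sub_sq {E : Type*} [NormedAddCommGroup E] [NormedSpace ℝ E]
    {g : E → ℝ} {g' : E → E →L[ℝ] ℝ} {x : E} {ε : ℝ} (hε : 0 ≤ ε)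
    (hg : ∀ y, HasFDerivAt g (g' y) y) (h0 : g x = 0)
    (hb : ∀ᶠ y in 𝓝 x, ‖g' y‖ ≤ ε * ‖y - x‖) :
    ∀ᶠ y in 𝓝 x, |g y| ≤ ε * ‖y - x‖ ^ 2 := by
  obtain ⟨δ, hδ, hball⟩ := Metric.eventually_nhds_iff_ball.1 hb
  filter_upwards [Metric.ball_mem_nhds x hδ] with y hy
  have hseg : segment ℝ x y ⊆ Metric.ball x δ :=
    (convex_ball x δ).segment_subset (Metric.mem_ball_self hδ) hy
  have hsub : ∀ z ∈ segment ℝ x y, ‖z - x‖ ≤ ‖y - x‖ := by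
    intro z hz
    have := (convex_closedBall x ‖y - x‖).segment_subset
      (Metric.mem_closedBall_self (norm_nonneg _)) (by simp [dist_eq_norm]) hz
    simpa [dist_eq_norm] using this
  have key := Convex.norm_image_sub_le_of_norm_hasFDerivWithin_le
    (s := segment ℝ x y) (C := ε * ‖y - x‖) (fun z _ => (hg z).hasFDerivWithinAt)
    (fun z hz => (hball z (hseg hz)).trans
      (mul_le_mul_of_nonneg_left (hsub z hz) hε))
    (convex_segment x y) (left_mem_segment ℝ x y) (right_mem_segment ℝ x y)
  rw [h0, sub_zero, Real.norm_eq_abs] at key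
  calc |g y| ≤ ε * ‖y - x‖ * ‖y - x‖ := key
    _ = _ := by ring

/-- Second-order Taylor expansion with Peano remainder in a normed space. -/
theorem eventually_abs_taylor_two_le {E : Type*} [NormedAddCommGroup E] [NormedSpace ℝ E]
    {f : E → ℝ} {f' : E → E →L[ℝ] ℝ} {f'' : E →L[ℝ] E →L[ℝ] ℝ} {x : E}
    (hf : ∀ y, HasFDerivAt f (f' y) y) (hx : HasFDerivAt f' f'' x) {ε : ℝ} (hε : 0 < ε) :
    ∀ᶠ y in 𝓝 x,
      |f y - f x - f' x (y - x) - f'' (y - x) (y - x) / 2| ≤ ε * ‖y - x‖ ^ 2 := by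
  have hsymm := second_derivative_symmetric hf hx
  have hsub : ∀ y, HasFDerivAt (fun y : E => y - x) (ContinuousLinearMap.id ℝ E) y :=
    fun y => (hasFDerivAt_id y).sub_const x
  refine eventually_norm_le_mul_norm_sub_sq
    (g := fun y => f y - f x - f' x (y - x) - f'' (y - x) (y - x) / 2)
    (g' := fun y => f' y - f' x - f'' (y - x)) hε.le ?_ (by simp) ?_
  · intro y
    have h1 := (((hf y).sub_const (f x)).sub ((f' x).hasFDerivAt.comp y (hsub y))).sub
      (((f''.hasFDerivAt.comp y (hsub y)).clm_apply (hsub y)).mul_const (1 / 2 : ℝ))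
    refine (h1.congr_fderiv ?_).congr_of_eventuallyEq (Eventually.of_forall fun z => ?_)
    · ext v
      have hv := hsymm v (y - x)
      simp only [map_sub, sub_apply] at hv
      simp
      linarith
    · simp [div_eq_mul_inv]
  · simpa using (hasFDerivAt_iff_isLittleO.1 hx).def hε

/-- Second-order Taylor expansion with Peano remainder on the real line. -/
theorem eventually_abs_taylor_two_le_real {f f' : ℝ → ℝ} {q x : ℝ}
    (hf : ∀ y, HasDerivAt f (f' y) y) (hx : HasDerivAt f' q x) {ε : ℝ} (hε : 0 < ε) :
    ∀ᶠ y in 𝓝 x,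
      |f y - f x - f' x * (y - x) - q / 2 * (y - x) ^ 2| ≤ ε * (y - x) ^ 2 := by
  have key := eventually_norm_le_mul_norm_sub_sq (x := x)
    (g := fun y => f y - f x - f' x * (y - x) - q / 2 * (y - x) ^ 2)
    (g' := fun y => ContinuousLinearMap.toSpanSingleton ℝ (f' y - f' x - q * (y - x))) hε.le
    (fun y => ?_) (by simp) ?_
  · simpa using key
  · have h1 := (((hf y).sub_const (f x)).sub (((hasDerivAt_id y).sub_const x).const_mul (f' x))).sub
      ((((hasDerivAt_id y).sub_const x).pow 2).const_mul (q / 2))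
    refine HasDerivAt.hasFDerivAt (h1.congr_deriv ?_)
    simp
    ring
  · have := (hasDerivAt_iff_isLittleO.1 hx).def hε
    filter_upwards [this] with y hy
    simpa [mul_comm] using hy

section QuadraticTest

variable {E : Type*} [NormedAddCommGroup E] [InnerProductSpace ℝ E]

/-- The quadratic `c + p⟪x - y, e⟫ + A⟪x - y, e⟫² + B‖x - y‖²`. -/
noncomputable def axialQuadratic (y e : E) (c p A B : ℝ) (x : E) : ℝ :=
  c + p * ⟪e, x - y⟫ + A * ⟪e, x - y⟫ ^ 2 + B * ⟪x - y, x - y⟫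

theorem contDiff_axialQuadratic (y e : E) (c p A B : ℝ) :
    ContDiff ℝ 2 (axialQuadratic y e c p A B) := by
  have hsub : ContDiff ℝ 2 fun x : E => x - y := contDiff_id.sub contDiff_const
  have h1 : ContDiff ℝ 2 fun x : E => ⟪e, x - y⟫ := contDiff_const.inner ℝ hsub
  exact ((contDiff_const.add (contDiff_const.mul h1)).add (contDiff_const.mul (h1.pow 2))).add
    (contDiff_const.mul (hsub.inner ℝ hsub))

theorem hasFDerivAt_axialQuadratic (y e : E) (c p A B : ℝ) (x : E) :
    HasFDerivAt (axialQuadratic y e c p A B)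
      (p • innerSL ℝ e + (2 * A * ⟪e, x - y⟫) • innerSL ℝ e + (2 * B) • innerSL ℝ (x - y)) x := by
  have hsub : HasFDerivAt (fun x : E => x - y) (ContinuousLinearMap.id ℝ E) x :=
    (hasFDerivAt_id x).sub_const y
  have h1 : HasFDerivAt (fun x : E => ⟪e, x - y⟫) (innerSL ℝ e) x :=
    ((innerSL ℝ e).hasFDerivAt.comp x hsub).congr_fderiv (by ext; simp)
  have h2 := ((((h1.const_mul p).const_add c).add ((h1.pow 2).const_mul A)).add
    ((hsub.inner ℝ hsub).const_mul B))
  refine h2.congr_fderiv ?_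
  ext v
  have hv := real_inner_comm v (x - y)
  have hv' := inner_sub_left (𝕜 := ℝ) x y v
  simp [fderivInnerCLM_apply] at hv' ⊢
  linear_combination 2 * B * hv' - B * hv

theorem hasFDerivAt_fderiv_axialQuadratic (y e : E) (c p A B : ℝ) (x : E) :
    HasFDerivAt (fderiv ℝ (axialQuadratic y e c p A B))
      ((2 * A) • (innerSL ℝ e).smulRight (innerSL ℝ e) +
        (2 * B) • (isBoundedBilinearMap_inner (𝕜 := ℝ) (E := E)).toContinuousLinearMap) x := by
  have heq : fderiv ℝ (axialQuadratic y e c p A B) = fun x =>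
      p • innerSL ℝ e + (2 * A * ⟪e, x - y⟫) • innerSL ℝ e + (2 * B) • innerSL ℝ (x - y) :=
    funext fun x => (hasFDerivAt_axialQuadratic y e c p A B x).fderiv
  rw [heq]
  have hsub : HasFDerivAt (fun x : E => x - y) (ContinuousLinearMap.id ℝ E) x :=
    (hasFDerivAt_id x).sub_const y
  have h1 : HasFDerivAt (fun x : E => ⟪e, x - y⟫) (innerSL ℝ e) x :=
    ((innerSL ℝ e).hasFDerivAt.comp x hsub).congr_fderiv (by ext; simp)
  have h2 := (((h1.const_mul (2 * A)).smul_const (innerSL ℝ e)).const_add (p • innerSL ℝ e)).add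
    (((isBoundedBilinearMap_inner (𝕜 := ℝ) (E := E)).toContinuousLinearMap.hasFDerivAt.comp x
      hsub).const_smul (2 * B))
  refine h2.congr_fderiv ?_
  ext v w
  simp
  ring

end QuadraticTest

theorem secondDeriv_eq_fderiv {n : ℕ} (φ : EuclideanSpace ℝ (Fin n) → ℝ)
    (x v : EuclideanSpace ℝ (Fin n)) :
    secondDeriv φ x v = fderiv ℝ (fderiv ℝ φ) x v v := by
  simp [secondDeriv, iteratedFDeriv_two_apply]

theorem secondDeriv_axialQuadratic {n : ℕ} (y e x v : EuclideanSpace ℝ (Fin n)) (c p A B : ℝ) :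
    secondDeriv (axialQuadratic y e c p A B) x v = 2 * A * ⟪e, v⟫ ^ 2 + 2 * B * ‖v‖ ^ 2 := by
  rw [secondDeriv_eq_fderiv, (hasFDerivAt_fderiv_axialQuadratic y e c p A B x).fderiv]
  simp [-mul_eq_mul_left_iff]
  ring

theorem gradient_axialQuadratic_self {n : ℕ} (y e : EuclideanSpace ℝ (Fin n)) (c p A B : ℝ) :
    gradient (axialQuadratic y e c p A B) y = p • e := by
  refine HasGradientAt.gradient (hasGradientAt_iff_hasFDerivAt.2 ?_)
  refine (hasFDerivAt_axialQuadratic y e c p A B y).congr_fderiv ?_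
  ext v
  simp

theorem laplInfMinus_axialQuadratic_self {n : ℕ} {y e : EuclideanSpace ℝ (Fin n)}
    (he : ‖e‖ = 1) {c p A B : ℝ} (h : p ≠ 0 ∨ A = 0) :
    laplInfMinus (axialQuadratic y e c p A B) y = 2 * A + 2 * B := by
  have he0 : e ≠ 0 := fun h0 => by simp [h0] at he
  unfold laplInfMinus
  rw [gradient_axialQuadratic_self]
  simp only [secondDeriv_axialQuadratic]
  by_cases hp : p = 0
  · obtain rfl : A = 0 := h.resolve_left (not_not.2 hp)
    have hset : {t : ℝ | ∃ v : EuclideanSpace ℝ (Fin n), ‖v‖ = 1 ∧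
        t = 2 * 0 * ⟪e, v⟫ ^ 2 + 2 * B * ‖v‖ ^ 2} = {2 * B} := by
      ext t
      constructor
      · rintro ⟨v, hv, rfl⟩
        simp [hv]
      · rintro rfl
        exact ⟨e, he, by simp [he]⟩
    simp only [hp, zero_smul, if_true, hset, csInf_singleton]
    ring
  · rw [if_neg (smul_ne_zero hp he0), norm_smul, he, inner_smul_right,
      real_inner_self_eq_norm_sq, he, Real.norm_eq_abs, mul_one, sq_abs]
    field_simp

theorem SuperPair.le_sub_of_axialQuadratic_le {n : ℕ} {U : Set (EuclideanSpace ℝ (Fin n))}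
    (hU : IsOpen U) {u v : EuclideanSpace ℝ (Fin n) → ℝ} (h : SuperPair U u v)
    {y e : EuclideanSpace ℝ (Fin n)} (hy : y ∈ U) (he : ‖e‖ = 1) {p A B : ℝ}
    (hpA : p ≠ 0 ∨ A = 0)
    (hle : ∀ᶠ x in 𝓝 y, axialQuadratic y e (u y) p A B x ≤ u x) :
    2 * A + 2 * B ≤ u y - v y := by
  have hmin : IsLocalMinOn (fun x => u x - axialQuadratic y e (u y) p A B x) U y := by
    rw [IsLocalMinOn, IsMinFilter, hU.nhdsWithin_eq hy]
    filter_upwards [hle] with x hx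
    have : axialQuadratic y e (u y) p A B y = u y := by simp [axialQuadratic]
    simp only [this]
    linarith
  have := h _ (contDiff_axialQuadratic y e (u y) p A B) y hy hmin
  rw [laplInfMinus_axialQuadratic_self he hpA] at this
  linarith

theorem quadratic_axial_le_radial {ρ d s N p q : ℝ} (hρ : 0 < ρ) (hN1 : N ≤ 1) (hNρ : N ≤ ρ / 2)
    (hd : |d| ≤ N) (hs : |s| ≤ N) (h : 2 * ρ * d + d ^ 2 = 2 * ρ * s + N ^ 2) :
    p * s + (q / 2 + (|p| + |q|) / ρ) * s ^ 2 + -((|p| + |q|) / ρ) * N ^ 2 ≤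
      p * d + q / 2 * d ^ 2 := by
  obtain ⟨hd1, hd2⟩ := abs_le.1 hd
  obtain ⟨hs1, hs2⟩ := abs_le.1 hs
  have hds : 0 ≤ d - s := by
    have : d ^ 2 ≤ N ^ 2 := sq_le_sq' hd1 hd2
    by_contra hlt
    nlinarith
  have hle : d - s ≤ (N ^ 2 - s ^ 2) / ρ := by
    rw [le_div_iff₀ hρ]
    nlinarith [mul_nonneg hds (by linarith : 0 ≤ ρ + d + s)]
  have hp : -(|p| * ((N ^ 2 - s ^ 2) / ρ)) ≤ p * (d - s) := by
    have := mul_le_mul_of_nonneg_left hle (abs_nonneg p)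
    have := mul_le_mul_of_nonneg_right (neg_abs_le p) hds
    linarith
  have hq : -(|q| * ((N ^ 2 - s ^ 2) / ρ)) ≤ q / 2 * (d ^ 2 - s ^ 2) := by
    have h1 : |(d + s) / 2| ≤ 1 := abs_le.2 ⟨by linarith, by linarith⟩
    have h2 : |q * ((d + s) / 2)| ≤ |q| := by
      rw [abs_mul]
      exact mul_le_of_le_one_right (abs_nonneg q) h1
    have h3 := mul_le_mul_of_nonneg_right (neg_le_of_abs_le h2) hds
    have h4 := mul_le_mul_of_nonneg_left hle (abs_nonneg q)
    linarith
  have e1 : (|p| + |q|) / ρ * (N ^ 2 - s ^ 2) =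
      |p| * ((N ^ 2 - s ^ 2) / ρ) + |q| * ((N ^ 2 - s ^ 2) / ρ) := by ring
  linarith

theorem SuperPair.le_sub_of_radial_touching {n : ℕ} {U : Set (EuclideanSpace ℝ (Fin n))}
    (hU : IsOpen U) {u v : EuclideanSpace ℝ (Fin n) → ℝ} (h : SuperPair U u v)
    {y z : EuclideanSpace ℝ (Fin n)} (hy : y ∈ U) (hyz : y ≠ z) {k : ℝ → ℝ} {p q : ℝ}
    (hk : ∀ q' < q, ∀ᶠ s in 𝓝 ‖y - z‖,
      k ‖y - z‖ + p * (s - ‖y - z‖) + q' / 2 * (s - ‖y - z‖) ^ 2 ≤ k s)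
    (hmin : ∀ᶠ x in 𝓝 y, u y - k ‖y - z‖ ≤ u x - k ‖x - z‖) (hpq : p ≠ 0 ∨ q ≤ 0) :
    q ≤ u y - v y := by
  refine le_of_forall_lt_imp_le_of_dense fun q' hq' => ?_
  have hρ : 0 < ‖y - z‖ := norm_pos_iff.2 (sub_ne_zero.2 hyz)
  set ρ := ‖y - z‖ with hρdef
  set e := ρ⁻¹ • (y - z) with hedef
  have he : ‖e‖ = 1 := by
    rw [hedef, norm_smul, norm_inv, Real.norm_of_nonneg hρ.le, ← hρdef, inv_mul_cancel₀ hρ.ne']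
  have hye : y - z = ρ • e := by rw [hedef, smul_smul, mul_inv_cancel₀ hρ.ne', one_smul]
  have hcont : Tendsto (fun x => ‖x - z‖) (𝓝 y) (𝓝 ρ) :=
    (continuous_id.sub continuous_const).norm.tendsto y
  have hkey := hcont.eventually (hk q' hq')
  have habs : ∀ x, |‖x - z‖ - ρ| ≤ ‖x - y‖ := fun x => by
    simpa [hρdef] using abs_norm_sub_norm_le (x - z) (y - z)
  by_cases hp : p = 0
  · have hq0 : q' ≤ 0 := (hq'.trans_le (hpq.resolve_left (not_not.2 hp))).le
    have := h.le_sub_of_axialQuadratic_le hU hy he (p := 0) (A := 0) (B := q' / 2) (Or.inr rfl) ?_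
    · linarith
    · filter_upwards [hkey, hmin] with x hx hm
      have : (‖x - z‖ - ρ) ^ 2 ≤ ‖x - y‖ ^ 2 := sq_le_sq' (abs_le.1 (habs x)).1 (abs_le.1 (habs x)).2
      simp only [axialQuadratic, real_inner_self_eq_norm_sq]
      rw [hp] at hx
      nlinarith
  · have := h.le_sub_of_axialQuadratic_le hU hy he (p := p) (A := q' / 2 + (|p| + |q'|) / ρ)
      (B := -((|p| + |q'|) / ρ)) (Or.inl hp) ?_
    · linarith
    · filter_upwards [hkey, hmin, Metric.closedBall_mem_nhds y one_pos,
        Metric.closedBall_mem_nhds y (half_pos hρ)] with x hx hm h1 h2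
      rw [mem_closedBall, dist_eq_norm] at h1 h2
      have hs : |⟪e, x - y⟫| ≤ ‖x - y‖ := by
        simpa [he] using abs_real_inner_le_norm e (x - y)
      have hxz : ‖x - z‖ ^ 2 = ρ ^ 2 + 2 * ρ * ⟪e, x - y⟫ + ‖x - y‖ ^ 2 := by
        rw [show x - z = ρ • e + (x - y) by rw [← hye]; abel, norm_add_sq_real, norm_smul, he,
          inner_smul_left]
        simp
        ring
      have := quadratic_axial_le_radial (p := p) (q := q') hρ h1 h2 (habs x) hs
        (by linear_combination hxz)
      simp only [axialQuadratic, real_inner_self_eq_norm_sq]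
      linarith

/-- Radial profile of the first component of a generalized cone pair. -/
noncomputable def coneProfile (C₁ C₂ a b τ : ℝ) : ℝ :=
  C₁ * Real.exp (Real.sqrt 2 * τ) + C₂ * Real.exp (-(Real.sqrt 2 * τ)) + a * τ + b

theorem cone₁_eq_coneProfile {n : ℕ} (z x : EuclideanSpace ℝ (Fin n)) (C₁ C₂ a b : ℝ) :
    cone₁ z C₁ C₂ a b x = coneProfile C₁ C₂ a b ‖x - z‖ := rfl

theorem cone₂_eq_coneProfile {n : ℕ} (z x : EuclideanSpace ℝ (Fin n)) (C₁ C₂ a b : ℝ) :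
    cone₂ z C₁ C₂ a b x = coneProfile (-C₁) (-C₂) a b ‖x - z‖ := by
  simp only [cone₂, coneProfile]
  ring

/-- A cone profile lifted by a small parabola, which makes the cone a strict subsolution. -/
noncomputable def strictProfile (ε R C₁ C₂ a b τ : ℝ) : ℝ :=
  coneProfile C₁ C₂ a b τ + ε * (τ ^ 2 - R ^ 2)

noncomputable def strictProfileDeriv (ε C₁ C₂ a τ : ℝ) : ℝ :=
  Real.sqrt 2 * (C₁ * Real.exp (Real.sqrt 2 * τ) - C₂ * Real.exp (-(Real.sqrt 2 * τ))) + a +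
    2 * ε * τ

theorem hasDerivAt_exp_sqrt_two_mul (τ : ℝ) :
    HasDerivAt (fun τ => Real.exp (Real.sqrt 2 * τ))
      (Real.sqrt 2 * Real.exp (Real.sqrt 2 * τ)) τ := by
  have := ((hasDerivAt_id τ).const_mul (Real.sqrt 2)).exp
  simpa [mul_comm] using this

theorem hasDerivAt_exp_neg_sqrt_two_mul (τ : ℝ) :
    HasDerivAt (fun τ => Real.exp (-(Real.sqrt 2 * τ)))
      (-(Real.sqrt 2 * Real.exp (-(Real.sqrt 2 * τ)))) τ := by
  have := ((hasDerivAt_id τ).const_mul (Real.sqrt 2)).neg.exp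
  simpa [mul_comm] using this

theorem hasDerivAt_strictProfile (ε R C₁ C₂ a b τ : ℝ) :
    HasDerivAt (strictProfile ε R C₁ C₂ a b) (strictProfileDeriv ε C₁ C₂ a τ) τ := by
  have h := (((((hasDerivAt_exp_sqrt_two_mul τ).const_mul C₁).add
    ((hasDerivAt_exp_neg_sqrt_two_mul τ).const_mul C₂)).add
    ((hasDerivAt_id τ).const_mul a)).add_const b).add
    ((((hasDerivAt_id τ).pow 2).sub_const (R ^ 2)).const_mul ε)
  refine h.congr_deriv ?_
  simp [strictProfileDeriv]
  ring

theorem hasDerivAt_strictProfileDeriv (ε C₁ C₂ a b τ : ℝ) :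
    HasDerivAt (strictProfileDeriv ε C₁ C₂ a)
      (coneProfile C₁ C₂ a b τ - coneProfile (-C₁) (-C₂) a b τ + 2 * ε) τ := by
  have h := ((((((hasDerivAt_exp_sqrt_two_mul τ).const_mul C₁).sub
    ((hasDerivAt_exp_neg_sqrt_two_mul τ).const_mul C₂)).const_mul (Real.sqrt 2)).add_const a).add
    ((hasDerivAt_id τ).const_mul (2 * ε)))
  refine h.congr_deriv ?_
  simp only [coneProfile]
  linear_combination (C₁ * Real.exp (Real.sqrt 2 * τ) + C₂ * Real.exp (-(Real.sqrt 2 * τ))) *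
    Real.mul_self_sqrt (by norm_num : (0 : ℝ) ≤ 2)

theorem continuous_strictProfile (ε R C₁ C₂ a b : ℝ) :
    Continuous (strictProfile ε R C₁ C₂ a b) :=
  continuous_iff_continuousAt.2 fun τ => (hasDerivAt_strictProfile ε R C₁ C₂ a b τ).continuousAt

theorem continuous_coneProfile (C₁ C₂ a b : ℝ) : Continuous (coneProfile C₁ C₂ a b) := by
  unfold coneProfile
  fun_prop

theorem SuperPair.false_of_strictProfile_touching {n : ℕ} {U : Set (EuclideanSpace ℝ (Fin n))}
    (hU : IsOpen U) {u v : EuclideanSpace ℝ (Fin n) → ℝ} (h : SuperPair U u v)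
    {y z : EuclideanSpace ℝ (Fin n)} {r : ℝ} (hrU : closedBall z r ⊆ U) (hy : y ∈ ball z r)
    (hyz : y ≠ z) {ε R C₁ C₂ a b δ t : ℝ} (hε : 0 < ε) (hδ : 0 < δ) (ht : t ∈ Icc 0 δ)
    (hmin : ∀ x ∈ closedBall z r, ∀ t' ∈ Icc 0 δ,
      u y - strictProfile ε R C₁ C₂ a b (‖y - z‖ + t) ≤
        u x - strictProfile ε R C₁ C₂ a b (‖x - z‖ + t'))
    (huv : u y - strictProfile ε R C₁ C₂ a b (‖y - z‖ + t) ≤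
        v y - strictProfile ε R (-C₁) (-C₂) a b (‖y - z‖ + t)) : False := by
  set s₀ := ‖y - z‖ + t with hs₀
  set p := strictProfileDeriv ε C₁ C₂ a s₀ with hp
  set q := coneProfile C₁ C₂ a b s₀ - coneProfile (-C₁) (-C₂) a b s₀ + 2 * ε with hq
  have htaylor : ∀ q' < q, ∀ᶠ s in 𝓝 s₀,
      strictProfile ε R C₁ C₂ a b s₀ + p * (s - s₀) + q' / 2 * (s - s₀) ^ 2 ≤
        strictProfile ε R C₁ C₂ a b s := by
    intro q' hq'
    filter_upwards [eventually_abs_taylor_two_le_real (hasDerivAt_strictProfile ε R C₁ C₂ a b)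
      (hasDerivAt_strictProfileDeriv ε C₁ C₂ a b s₀)
      (by linarith : 0 < (q - q') / 2)] with s hs
    have := (abs_le.1 hs).1
    simp only [← hp, ← hq] at this
    linarith
  have hpq : p ≠ 0 ∨ q ≤ 0 := by
    by_contra! hcon
    obtain ⟨hp0, hq0⟩ := hcon
    have hyr : y ∈ closedBall z r := ball_subset_closedBall hy
    have hmax : ∀ t' ∈ Icc 0 δ, strictProfile ε R C₁ C₂ a b (‖y - z‖ + t') ≤
        strictProfile ε R C₁ C₂ a b s₀ := fun t' ht' => by
      have := hmin y hyr t' ht'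
      linarith
    have hev : ∀ᶠ t' in 𝓝 t, t' ∈ Icc 0 δ → t' = t := by
      have hc : Tendsto (fun t' => ‖y - z‖ + t') (𝓝 t) (𝓝 s₀) :=
        (continuous_const.add continuous_id).tendsto t
      filter_upwards [hc.eventually (htaylor (q / 2) (by linarith))] with t' h1 h2
      have h3 := hmax t' h2
      rw [hp0] at h1
      have h4 : ‖y - z‖ + t' - s₀ = t' - t := by rw [hs₀]; ring
      rw [h4] at h1
      have h5 : (t' - t) ^ 2 ≤ 0 := by nlinarith [sq_nonneg (t' - t)]
      have := pow_eq_zero_iff (two_ne_zero) |>.1 (le_antisymm h5 (sq_nonneg _))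
      linarith
    obtain ⟨η, hη, hball⟩ := Metric.eventually_nhds_iff.1 hev
    rcases ht.2.lt_or_eq with hlt | heq
    · have hmp : 0 < min (η / 2) (δ - t) := lt_min (by linarith) (by linarith)
      have := @hball (t + min (η / 2) (δ - t)) (by
        rw [Real.dist_eq, add_sub_cancel_left, abs_of_pos hmp]
        linarith [min_le_left (η / 2) (δ - t)])
        ⟨by linarith [ht.1], by linarith [min_le_right (η / 2) (δ - t)]⟩
      linarith
    · have hmp : 0 < min (η / 2) t := lt_min (by linarith) (by linarith)
      have := @hball (t - min (η / 2) t) (by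
        rw [Real.dist_eq, sub_sub_cancel_left, abs_neg, abs_of_pos hmp]
        linarith [min_le_left (η / 2) t])
        ⟨by linarith [min_le_right (η / 2) t], by linarith [ht.2]⟩
      linarith
  have hle := h.le_sub_of_radial_touching hU (hrU (ball_subset_closedBall hy)) hyz
    (k := fun s => strictProfile ε R C₁ C₂ a b (s + t)) (p := p) (q := q) ?_ ?_ hpq
  · simp only [strictProfile] at huv
    linarith
  · intro q' hq'
    have hc : Tendsto (fun s => s + t) (𝓝 ‖y - z‖) (𝓝 s₀) :=
      (continuous_id.add continuous_const).tendsto _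
    filter_upwards [hc.eventually (htaylor q' hq')] with s hs
    have h4 : s + t - s₀ = s - ‖y - z‖ := by rw [hs₀]; ring
    rwa [h4] at hs
  · filter_upwards [isOpen_ball.mem_nhds hy] with x hx
    exact hmin x (ball_subset_closedBall hx) t ht

theorem exists_isMinOn_sub_strictProfile {n : ℕ} {u : EuclideanSpace ℝ (Fin n) → ℝ}
    {z : EuclideanSpace ℝ (Fin n)} {r : ℝ} (hr : 0 < r) (hu : ContinuousOn u (closedBall z r))
    (ε R C₁ C₂ a b : ℝ) {δ : ℝ} (hδ : 0 < δ) :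
    ∃ y ∈ closedBall z r, ∃ t ∈ Icc 0 δ, ∀ x ∈ closedBall z r, ∀ t' ∈ Icc 0 δ,
      u y - strictProfile ε R C₁ C₂ a b (‖y - z‖ + t) ≤
        u x - strictProfile ε R C₁ C₂ a b (‖x - z‖ + t') := by
  have hK : IsCompact (closedBall z r ×ˢ Icc (0 : ℝ) δ) :=
    (isCompact_closedBall z r).prod isCompact_Icc
  have hne : (closedBall z r ×ˢ Icc (0 : ℝ) δ).Nonempty :=
    ⟨(z, 0), mem_closedBall_self hr.le, left_mem_Icc.2 hδ.le⟩
  have hcont : ContinuousOn (fun w : EuclideanSpace ℝ (Fin n) × ℝ =>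
      u w.1 - strictProfile ε R C₁ C₂ a b (‖w.1 - z‖ + w.2)) (closedBall z r ×ˢ Icc (0 : ℝ) δ) := by
    refine (hu.comp continuousOn_fst fun w hw => hw.1).sub (Continuous.continuousOn ?_)
    exact (continuous_strictProfile ε R C₁ C₂ a b).comp
      ((continuous_fst.sub continuous_const).norm.add continuous_snd)
  obtain ⟨⟨y, t⟩, ⟨hy, ht⟩, hmin⟩ := hK.exists_isMinOn hne hcont
  exact ⟨y, hy, t, ht, fun x hx t' ht' => hmin (show (x, t') ∈ _ from ⟨hx, ht'⟩)⟩

theorem coneProfile_le_of_superPair {n : ℕ} {U : Set (EuclideanSpace ℝ (Fin n))}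
    (hU : IsOpen U) {u v : EuclideanSpace ℝ (Fin n) → ℝ} (huv : SuperPair U u v)
    (hvu : SuperPair U v u) {z : EuclideanSpace ℝ (Fin n)} {r : ℝ} (hr : 0 < r)
    (hrU : closedBall z r ⊆ U) (hu : ContinuousOn u (closedBall z r))
    (hv : ContinuousOn v (closedBall z r)) {C₁ C₂ a b : ℝ}
    (hub : ∀ x ∈ sphere z r ∪ {z}, coneProfile C₁ C₂ a b ‖x - z‖ ≤ u x)
    (hvb : ∀ x ∈ sphere z r ∪ {z}, coneProfile (-C₁) (-C₂) a b ‖x - z‖ ≤ v x) :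
    ∀ x ∈ closedBall z r, coneProfile C₁ C₂ a b ‖x - z‖ ≤ u x := by
  intro x₁ hx₁
  by_contra! hlt
  set m := coneProfile C₁ C₂ a b ‖x₁ - z‖ - u x₁ with hm
  have hm0 : 0 < m := by linarith
  set R := r + 1 with hR
  have hR0 : 0 < R := by linarith
  set ε := m / (2 * R ^ 2) with hεdef
  have hε : 0 < ε := by positivity
  have hεR : ε * R ^ 2 = m / 2 := by
    rw [hεdef]
    field_simp
  have hnear : ∀ D₁ D₂ s : ℝ, ∀ᶠ t in 𝓝 (0 : ℝ),
      coneProfile D₁ D₂ a b (s + t) < coneProfile D₁ D₂ a b s + m / 2 := by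
    intro D₁ D₂ s
    have hc : Tendsto (fun t => coneProfile D₁ D₂ a b (s + t)) (𝓝 0)
        (𝓝 (coneProfile D₁ D₂ a b (s + 0))) :=
      ((continuous_coneProfile D₁ D₂ a b).comp (continuous_const.add continuous_id)).tendsto 0
    rw [add_zero] at hc
    exact hc.eventually (gt_mem_nhds (by linarith))
  obtain ⟨η, hη, hball⟩ := Metric.eventually_nhds_iff.1
    (((hnear C₁ C₂ 0).and (hnear C₁ C₂ r)).and
      ((hnear (-C₁) (-C₂) 0).and (hnear (-C₁) (-C₂) r)))
  set δ := min (η / 2) 1 with hδdef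
  have hδ : 0 < δ := lt_min (by linarith) one_pos
  have hbdry : ∀ (w : EuclideanSpace ℝ (Fin n) → ℝ) (D₁ D₂ : ℝ),
      (∀ t ∈ Icc 0 δ, coneProfile D₁ D₂ a b (0 + t) < coneProfile D₁ D₂ a b 0 + m / 2) →
      (∀ t ∈ Icc 0 δ, coneProfile D₁ D₂ a b (r + t) < coneProfile D₁ D₂ a b r + m / 2) →
      (∀ x ∈ sphere z r ∪ {z}, coneProfile D₁ D₂ a b ‖x - z‖ ≤ w x) →
      ∀ y ∈ closedBall z r, ∀ t ∈ Icc 0 δ,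
        w y - strictProfile ε R D₁ D₂ a b (‖y - z‖ + t) ≤ -(m / 2) →
        y ∈ ball z r ∧ y ≠ z := by
    intro w D₁ D₂ h0 hr' hwb y hy t ht hneg
    have hyr : ‖y - z‖ ≤ r := by simpa [dist_eq_norm] using hy
    have hsmall : ε * ((‖y - z‖ + t) ^ 2 - R ^ 2) ≤ 0 := by
      have ht1 : t ≤ 1 := ht.2.trans (min_le_right _ _)
      have : (‖y - z‖ + t) ^ 2 ≤ R ^ 2 :=
        pow_le_pow_left₀ (add_nonneg (norm_nonneg _) ht.1) (by linarith) 2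
      exact mul_nonpos_of_nonneg_of_nonpos hε.le (by linarith)
    simp only [strictProfile] at hneg
    constructor
    · rw [mem_ball, dist_eq_norm]
      refine lt_of_le_of_ne hyr fun heq => ?_
      have h1 := hwb y (Or.inl (by rw [mem_sphere, dist_eq_norm, heq]))
      have h2 := hr' t ht
      rw [heq] at h1 hneg hsmall
      linarith
    · rintro rfl
      have h1 := hwb y (Or.inr rfl)
      have h2 := h0 t ht
      rw [sub_self, norm_zero] at h1 hneg hsmall
      linarith
  have hIcc : ∀ t ∈ Icc 0 δ, dist t 0 < η := fun t ht => by
    rw [Real.dist_eq, sub_zero, abs_of_nonneg ht.1]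
    linarith [ht.2, min_le_left (η / 2) 1]
  obtain ⟨y, hy, t, ht, hmin⟩ := exists_isMinOn_sub_strictProfile hr hu ε R C₁ C₂ a b hδ
  obtain ⟨y', hy', t', ht', hmin'⟩ :=
    exists_isMinOn_sub_strictProfile hr hv ε R (-C₁) (-C₂) a b hδ
  have hval : u y - strictProfile ε R C₁ C₂ a b (‖y - z‖ + t) ≤ -(m / 2) := by
    refine (hmin x₁ hx₁ 0 (left_mem_Icc.2 hδ.le)).trans ?_
    have : 0 ≤ ε * ‖x₁ - z‖ ^ 2 := by positivity
    simp only [strictProfile, add_zero]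
    linarith
  rcases le_total (u y - strictProfile ε R C₁ C₂ a b (‖y - z‖ + t))
    (v y' - strictProfile ε R (-C₁) (-C₂) a b (‖y' - z‖ + t')) with hle | hle
  · obtain ⟨hyb, hyz⟩ := hbdry u C₁ C₂ (fun s hs => (hball (hIcc s hs)).1.1)
      (fun s hs => (hball (hIcc s hs)).1.2) hub y hy t ht hval
    exact huv.false_of_strictProfile_touching hU hrU hyb hyz hε hδ ht hmin
      (hle.trans (hmin' y hy t ht))
  · obtain ⟨hyb, hyz⟩ := hbdry v (-C₁) (-C₂) (fun s hs => (hball (hIcc s hs)).2.1)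
      (fun s hs => (hball (hIcc s hs)).2.2) hvb y' hy' t' ht' (hle.trans hval)
    refine hvu.false_of_strictProfile_touching hU hrU hyb hyz hε hδ ht' hmin' ?_
    rw [neg_neg, neg_neg]
    exact hle.trans (hmin y' hy' t' ht')

theorem IsSupersolution.comparisonBelow {n : ℕ} {U : Set (EuclideanSpace ℝ (Fin n))}
    (hU : IsOpen U) {u₁ u₂ : EuclideanSpace ℝ (Fin n) → ℝ} (hu₁ : ContinuousOn u₁ U)
    (hu₂ : ContinuousOn u₂ U) (h : IsSupersolution U u₁ u₂) : ComparisonBelow U u₁ u₂ := by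
  intro z _ r hr hrU C₁ C₂ a b hb x hx
  simp only [cone₁_eq_coneProfile, cone₂_eq_coneProfile] at hb ⊢
  refine ⟨coneProfile_le_of_superPair hU h.2.2.1 h.2.2.2 hr hrU (hu₁.mono hrU) (hu₂.mono hrU)
    (fun x hx => (hb x hx).1) (fun x hx => (hb x hx).2) x hx,
    coneProfile_le_of_superPair hU h.2.2.2 h.2.2.1 hr hrU (hu₂.mono hrU) (hu₁.mono hrU)
    (fun x hx => (hb x hx).2) (fun x hx => ?_) x hx⟩
  simpa only [neg_neg] using (hb x hx).1

theorem ComparisonBelow.swap {n : ℕ} {U : Set (EuclideanSpace ℝ (Fin n))}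
    {u v : EuclideanSpace ℝ (Fin n) → ℝ} (h : ComparisonBelow U u v) : ComparisonBelow U v u := by
  intro z hz r hr hrU C₁ C₂ a b hb x hx
  have := h z hz r hr hrU (-C₁) (-C₂) a b
  simp only [cone₁_eq_coneProfile, cone₂_eq_coneProfile, neg_neg] at this hb ⊢
  exact (this (fun x hx => (hb x hx).symm) x hx).symm

theorem eventually_abs_coneProfile_sub_le (q : ℝ) {ε : ℝ} (hε : 0 < ε) :
    ∀ᶠ τ in 𝓝 (0 : ℝ),
      |coneProfile (q / 4) (q / 4) 0 0 τ - q / 2 - q / 2 * τ ^ 2| ≤ ε * τ ^ 2 := by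
  filter_upwards [eventually_abs_taylor_two_le_real
    (hasDerivAt_strictProfile 0 0 (q / 4) (q / 4) 0 0)
    (hasDerivAt_strictProfileDeriv 0 (q / 4) (q / 4) 0 0 0) hε] with τ hτ
  simp only [strictProfile, strictProfileDeriv, sub_zero, zero_mul, mul_zero, add_zero, sub_self,
    neg_zero] at hτ
  have h0 : coneProfile (q / 4) (q / 4) 0 0 0 = q / 2 := by
    simp [coneProfile]
    ring
  have h1 : coneProfile (-(q / 4)) (-(q / 4)) 0 0 0 = -(q / 2) := by
    simp [coneProfile]
    ring
  rw [h0, h1] at hτ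
  convert hτ using 2
  ring

/-- Comparison with the cone whose vertex lies at distance `θ * r` from `y` in direction `e`. -/
theorem ComparisonBelow.mul_sub_le {n : ℕ} {U : Set (EuclideanSpace ℝ (Fin n))}
    (hU : IsOpen U) {u v : EuclideanSpace ℝ (Fin n) → ℝ} (h : ComparisonBelow U u v)
    {y e : EuclideanSpace ℝ (Fin n)} (hy : y ∈ U) (hv : ContinuousAt v y) (he : ‖e‖ = 1)
    {p l D θ : ℝ} (hθ0 : 0 < θ) (hθ1 : θ < 1)
    (hvertex : ∀ᶠ r in 𝓝[>] (0 : ℝ),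
      u y + p * (θ * r) + l / 2 * (θ * r) ^ 2 ≤ u (y + (θ * r) • e))
    (hsphere : ∀ᶠ r in 𝓝[>] (0 : ℝ), ∀ ω : EuclideanSpace ℝ (Fin n), ‖ω‖ = 1 →
      u y - p * ((1 - θ) * r) + l / 2 * ((1 - θ) * r) ^ 2 - D * r ^ 2 ≤
        u (y + (θ * r) • e + r • ω)) :
    (1 - θ) * (l - (u y - v y)) ≤ 2 * D := by
  refine le_of_forall_pos_le_add fun ε' hε' => ?_
  obtain ⟨ε, hε, rfl⟩ : ∃ ε : ℝ, 0 < ε ∧ ε' = 5 * ε := ⟨ε' / 5, by linarith, by ring⟩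
  set q := u y - v y + ε with hq
  set W := coneProfile (q / 4) (q / 4) 0 0 with hW
  have hlow : Tendsto (fun r : ℝ => r) (𝓝[>] 0) (𝓝 0) := tendsto_id.mono_left nhdsWithin_le_nhds
  have hscale : Tendsto (fun r : ℝ => θ * r) (𝓝[>] 0) (𝓝 0) := by
    simpa using hlow.const_mul θ
  have hdouble : Tendsto (fun r : ℝ => 2 * r) (𝓝[>] 0) (𝓝 0) := by
    simpa using hlow.const_mul 2
  have hα : ∀ᶠ r in 𝓝[>] (0 : ℝ), u y + p * (θ * r) + l / 2 * (θ * r) ^ 2 < u y + ε / 4 := by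
    have hc : Continuous fun r : ℝ => u y + p * (θ * r) + l / 2 * (θ * r) ^ 2 := by fun_prop
    have := (hc.tendsto 0).mono_left (nhdsWithin_le_nhds (s := Ioi 0))
    exact this.eventually (gt_mem_nhds (by simp; linarith))
  have hβ : ∀ᶠ r in 𝓝[>] (0 : ℝ),
      u y - p * ((1 - θ) * r) + l / 2 * ((1 - θ) * r) ^ 2 - D * r ^ 2 < u y + ε / 4 := by
    have hc : Continuous fun r : ℝ =>
      u y - p * ((1 - θ) * r) + l / 2 * ((1 - θ) * r) ^ 2 - D * r ^ 2 := by fun_prop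
    have := (hc.tendsto 0).mono_left (nhdsWithin_le_nhds (s := Ioi 0))
    exact this.eventually (gt_mem_nhds (by simp; linarith))
  have hWlow : ∀ᶠ r in 𝓝[>] (0 : ℝ), q / 2 - ε / 4 < W r := by
    have := ((continuous_coneProfile (q / 4) (q / 4) 0 0).tendsto 0).mono_left
      (nhdsWithin_le_nhds (s := Ioi 0))
    refine this.eventually (lt_mem_nhds ?_)
    simp [coneProfile]
    linarith
  have hnear : ∀ᶠ x in 𝓝 y, x ∈ U ∧ v y - ε / 4 < v x :=
    (hU.eventually_mem hy).and (hv.eventually (lt_mem_nhds (by linarith)))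
  obtain ⟨η, hη, hball⟩ := Metric.eventually_nhds_iff.1 hnear
  have hTaylor := eventually_abs_coneProfile_sub_le q hε
  have hall := (eventually_mem_nhdsWithin (a := (0 : ℝ)) (s := Ioi 0)).and
    (hvertex.and (hsphere.and (hα.and (hβ.and (hWlow.and
      ((hdouble.eventually (gt_mem_nhds hη)).and
        ((hlow.eventually hTaylor).and (hscale.eventually hTaylor))))))))
  obtain ⟨r, hr0, hr1, hr2, hr3, hr4, hr5, hr6, hr7, hr8⟩ := hall.exists
  rw [mem_Ioi] at hr0
  set α := u y + p * (θ * r) + l / 2 * (θ * r) ^ 2 with hαdef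
  set β := u y - p * ((1 - θ) * r) + l / 2 * ((1 - θ) * r) ^ 2 - D * r ^ 2 with hβdef
  set z := y + (θ * r) • e with hz
  set b := α - q / 2 with hb
  set a := (β - W r - b) / r with ha
  have har : a * r = β - W r - b := by
    rw [ha]
    field_simp
  have hθr : θ * r < r := mul_lt_of_lt_one_left hr0 hθ1
  have hnorm : ‖y - z‖ = θ * r := by
    rw [hz, sub_add_cancel_left, norm_neg, norm_smul, he, mul_one, Real.norm_of_nonneg]
    positivity
  have hsub : ∀ x ∈ closedBall z r, dist x y < η := by
    intro x hx
    have h1 := dist_triangle x z y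
    rw [mem_closedBall] at hx
    rw [dist_comm z y, dist_eq_norm y z, hnorm] at h1
    linarith
  have hzz : z ∈ closedBall z r := mem_closedBall_self hr0.le
  have hprof₁ : ∀ τ, coneProfile (q / 4) (q / 4) a b τ = W τ + a * τ + b := fun τ => by
    simp [hW, coneProfile]
  have hprof₂ : ∀ τ, coneProfile (-(q / 4)) (-(q / 4)) a b τ = -W τ + a * τ + b := fun τ => by
    simp [hW, coneProfile]
    ring
  have hW0 : W 0 = q / 2 := by
    simp [hW, coneProfile]
    ring
  have hcmp := h z (hball (hsub z hzz)).1 r hr0 (fun x hx => (hball (hsub x hx)).1)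
    (q / 4) (q / 4) a b ?_ y (by rw [mem_closedBall, dist_eq_norm, hnorm]; exact hθr.le)
  · have hkey := hcmp.1
    rw [cone₁_eq_coneProfile, hnorm, hprof₁] at hkey
    have t1 := (abs_le.1 hr7).2
    have t2 := (abs_le.1 hr8).1
    change W r - _ - _ ≤ _ at t1
    change _ ≤ W (θ * r) - _ - _ at t2
    have t3 := mul_le_mul_of_nonneg_left t1 hθ0.le
    have t4 : a * (θ * r) = θ * (β - W r - b) := by rw [← har]; ring
    rw [t4, hb, hαdef, hβdef] at hkey
    have t5 : θ * r ^ 2 * ((1 - θ) * (l - q)) ≤ θ * r ^ 2 * (2 * D + 2 * ε * (1 + θ)) := by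
      linarith
    have t6 := le_of_mul_le_mul_left t5 (by positivity)
    rw [hq] at t6
    have t7 : ε * θ ≤ ε := mul_le_of_le_one_right hε.le hθ1.le
    linarith
  · rintro x (hx | hx)
    · have hxr : ‖x - z‖ = r := by simpa [dist_eq_norm] using hx
      rw [cone₁_eq_coneProfile, cone₂_eq_coneProfile, hxr, hprof₁, hprof₂, har]
      have h1 := hr2 (r⁻¹ • (x - z)) (by
        rw [norm_smul, hxr, norm_inv, Real.norm_of_nonneg hr0.le, inv_mul_cancel₀ hr0.ne'])
      rw [smul_smul, mul_inv_cancel₀ hr0.ne', one_smul, add_sub_cancel] at h1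
      have h2 := (hball (hsub x (sphere_subset_closedBall hx))).2
      constructor <;> linarith
    · obtain rfl : x = z := hx
      rw [cone₁_eq_coneProfile, cone₂_eq_coneProfile, sub_self, norm_zero, hprof₁, hprof₂, hW0]
      have h2 := (hball (hsub _ hzz)).2
      constructor <;> linarith

theorem tendsto_add_smul_nhdsGT {E : Type*} [NormedAddCommGroup E] [NormedSpace ℝ E]
    (y e : E) (θ : ℝ) :
    Tendsto (fun r : ℝ => y + (θ * r) • e) (𝓝[>] 0) (𝓝 y) := by
  have hc : Continuous fun r : ℝ => y + (θ * r) • e := by fun_prop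
  simpa using (hc.tendsto 0).mono_left (nhdsWithin_le_nhds (s := Ioi 0))

theorem eventually_forall_unit {E : Type*} [NormedAddCommGroup E] [NormedSpace ℝ E]
    {y e : E} (he : ‖e‖ = 1) {θ : ℝ} {P : E → Prop} (hP : ∀ᶠ x in 𝓝 y, P x) :
    ∀ᶠ r in 𝓝[>] (0 : ℝ), ∀ ω : E, ‖ω‖ = 1 → P (y + (θ * r) • e + r • ω) := by
  obtain ⟨η, hη, hball⟩ := Metric.eventually_nhds_iff.1 hP
  have hpos : 0 < η / (|θ| + 1) := by positivity
  filter_upwards [Ioo_mem_nhdsGT hpos] with r hr ω hω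
  refine hball ?_
  rw [dist_eq_norm, show y + (θ * r) • e + r • ω - y = (θ * r) • e + r • ω by abel]
  have h1 := norm_add_le ((θ * r) • e) (r • ω)
  rw [norm_smul, norm_smul, he, hω, norm_mul, Real.norm_eq_abs, Real.norm_eq_abs,
    abs_of_pos hr.1] at h1
  have h2 := (lt_div_iff₀ (by positivity)).1 hr.2
  linarith

theorem ComparisonBelow.le_sub_of_gradient {n : ℕ} {U : Set (EuclideanSpace ℝ (Fin n))}
    (hU : IsOpen U) {u v : EuclideanSpace ℝ (Fin n) → ℝ} (h : ComparisonBelow U u v)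
    {y e : EuclideanSpace ℝ (Fin n)} (hy : y ∈ U) (hv : ContinuousAt v y) (he : ‖e‖ = 1)
    {p : ℝ} (hp : 0 < p)
    {B : EuclideanSpace ℝ (Fin n) →L[ℝ] EuclideanSpace ℝ (Fin n) →L[ℝ] ℝ}
    (hle : ∀ᶠ x in 𝓝 y, u y + p * ⟪e, x - y⟫ + B (x - y) (x - y) / 2 ≤ u x) :
    B e e ≤ u y - v y := by
  have hmain : ∀ D > 0, (1 - 1 / 2 : ℝ) * (B e e - (u y - v y)) ≤ 2 * D := by
    intro D hD
    refine h.mul_sub_le hU hy hv he (p := p) (by norm_num) (by norm_num) ?_ ?_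
    · filter_upwards [(tendsto_add_smul_nhdsGT y e (1 / 2)).eventually hle] with r hr
      simp only [add_sub_cancel_left, inner_smul_right, real_inner_self_eq_norm_sq, he,
        map_smul, smul_apply, smul_eq_mul] at hr
      linarith
    · have hpos : 0 < p * D / (2 * (‖B‖ ^ 2 + 1)) := by positivity
      filter_upwards [eventually_forall_unit he (θ := 1 / 2) hle, Ioo_mem_nhdsGT hpos]
        with r hr hrI ω hω
      refine le_trans ?_ (hr ω hω)
      have hr0 : 0 < r := hrI.1
      set ξ := ω + e with hξ
      have hdiff : y + (1 / 2 * r) • e + r • ω - y = r • ξ - (r / 2) • e := by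
        rw [hξ]
        module
      have hξe : ⟪e, ξ⟫ = ‖ξ‖ ^ 2 / 2 := by
        rw [hξ, norm_add_sq_real, inner_add_right, real_inner_self_eq_norm_sq, he, hω,
          real_inner_comm]
        ring
      have ht2 : ‖ξ‖ ≤ 2 := (norm_add_le _ _).trans (by rw [hω, he]; norm_num)
      have b1 : |B e ξ| ≤ ‖B‖ * ‖ξ‖ := by simpa [he] using B.le_opNorm₂ e ξ
      have b2 : |B ξ e| ≤ ‖B‖ * ‖ξ‖ := by simpa [he] using B.le_opNorm₂ ξ e
      have b3 : |B ξ ξ| ≤ ‖B‖ * ‖ξ‖ * ‖ξ‖ := by simpa using B.le_opNorm₂ ξ ξ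
      rw [hdiff]
      simp only [inner_sub_right, inner_smul_right, real_inner_self_eq_norm_sq, he, hξe, map_sub,
        map_smul, sub_apply, smul_apply, smul_eq_mul]
      set t := ‖ξ‖ with ht
      set M := ‖B‖ with hM
      have hM0 : 0 ≤ M := norm_nonneg B
      have ht0 : 0 ≤ t := norm_nonneg ξ
      have b4 : M * t * t ≤ 2 * (M * t) := by nlinarith [mul_nonneg hM0 ht0]
      have hrM : M ^ 2 * r ≤ p * D / 2 := by
        have := (lt_div_iff₀ (by positivity)).1 hrI.2
        nlinarith
      have hquad : 0 ≤ p * t ^ 2 / 2 - 3 / 2 * M * t * r + D * r := by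
        have e1 : 0 ≤ r * (D - 3 / 4 * (M * t)) ^ 2 := by positivity
        have e2 := mul_le_mul_of_nonneg_right hrM (sq_nonneg t)
        have e3 : 0 ≤ p * D * t ^ 2 := by positivity
        have : 0 ≤ D * (p * t ^ 2 / 2 - 3 / 2 * M * t * r + D * r) := by nlinarith
        exact nonneg_of_mul_nonneg_right this hD
      have hmul := mul_nonneg hr0.le hquad
      have c1 := mul_le_mul_of_nonneg_left (abs_le.1 b1).2 (sq_nonneg r)
      have c2 := mul_le_mul_of_nonneg_left (abs_le.1 b2).2 (sq_nonneg r)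
      have c3 := mul_le_mul_of_nonneg_left (abs_le.1 b3).1 (sq_nonneg r)
      have c4 := mul_le_mul_of_nonneg_left b4 (sq_nonneg r)
      linarith
  have : B e e - (u y - v y) ≤ 0 := le_of_forall_pos_le_add fun D hD => by
    have := hmain (D / 4) (by linarith)
    linarith
  linarith

theorem ComparisonBelow.le_sub_of_paraboloid {n : ℕ} {U : Set (EuclideanSpace ℝ (Fin n))}
    (hU : IsOpen U) {u v : EuclideanSpace ℝ (Fin n) → ℝ} (h : ComparisonBelow U u v)
    {y e : EuclideanSpace ℝ (Fin n)} (hy : y ∈ U) (hv : ContinuousAt v y) (he : ‖e‖ = 1)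
    {l : ℝ} (hle : ∀ᶠ x in 𝓝 y, u y + l / 2 * ‖x - y‖ ^ 2 ≤ u x) :
    l ≤ u y - v y := by
  have hmain : ∀ θ : ℝ, 0 < θ → θ < 1 →
      (1 - θ) * (l - (u y - v y)) ≤ 2 * (2 * |l| * θ) := by
    intro θ hθ0 hθ1
    refine h.mul_sub_le hU hy hv he (p := 0) hθ0 hθ1 ?_ ?_
    · filter_upwards [(tendsto_add_smul_nhdsGT y e θ).eventually hle] with r hr
      rw [add_sub_cancel_left, norm_smul, he, mul_one, Real.norm_eq_abs, sq_abs] at hr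
      linarith
    · filter_upwards [eventually_forall_unit he (θ := θ) hle] with r hr ω hω
      refine le_trans ?_ (hr ω hω)
      have hinner : |⟪e, ω⟫| ≤ 1 := by simpa [he, hω] using abs_real_inner_le_norm e ω
      rw [show y + (θ * r) • e + r • ω - y = (θ * r) • e + r • ω by abel, norm_add_sq_real,
        norm_smul, norm_smul, he, hω, inner_smul_left, inner_smul_right, mul_one, mul_one,
        Real.norm_eq_abs, Real.norm_eq_abs, sq_abs, sq_abs]
      simp only [conj_trivial]
      have h1 : 0 ≤ 1 + ⟪e, ω⟫ := by linarith [(abs_le.1 hinner).1]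
      have h2 : -(2 * |l|) ≤ l * (1 + ⟪e, ω⟫) := by
        have := mul_le_mul_of_nonneg_right (neg_abs_le l) h1
        have := mul_le_mul_of_nonneg_left (abs_le.1 hinner).2 (abs_nonneg l)
        linarith
      have h3 := mul_le_mul_of_nonneg_left h2 (by positivity : 0 ≤ θ * r ^ 2)
      linarith
  by_contra! hlt
  set g := l - (u y - v y) with hg
  have hg0 : 0 < g := by linarith
  have hpos : 0 < 4 * |l| + g := by positivity
  have hθ : g / (2 * (4 * |l| + g)) * (4 * |l| + g) = g / 2 := by
    field_simp
  have := hmain (g / (2 * (4 * |l| + g))) (by positivity) (by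
    rw [div_lt_one (by positivity)]
    linarith [abs_nonneg l])
  linarith

theorem eventually_taylor_le_of_isLocalMinOn {n : ℕ} {U : Set (EuclideanSpace ℝ (Fin n))}
    (hU : IsOpen U) {u φ : EuclideanSpace ℝ (Fin n) → ℝ} {y : EuclideanSpace ℝ (Fin n)}
    (hy : y ∈ U) (hφ : ContDiff ℝ 2 φ) (hmin : IsLocalMinOn (fun x => u x - φ x) U y)
    {η : ℝ} (hη : 0 < η) :
    ∀ᶠ x in 𝓝 y, u y + ⟪gradient φ y, x - y⟫ +
      (fderiv ℝ (fderiv ℝ φ) y (x - y) (x - y) - η * ‖x - y‖ ^ 2) / 2 ≤ u x := by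
  rw [IsLocalMinOn, IsMinFilter, hU.nhdsWithin_eq hy] at hmin
  have hd : ∀ x, HasFDerivAt φ (fderiv ℝ φ x) x := fun x =>
    (hφ.differentiable (by norm_num) x).hasFDerivAt
  have hd2 : HasFDerivAt (fderiv ℝ φ) (fderiv ℝ (fderiv ℝ φ) y) y :=
    ((hφ.fderiv_right (m := 1) (by norm_num)).differentiable (by norm_num) y).hasFDerivAt
  filter_upwards [hmin, eventually_abs_taylor_two_le hd hd2 (half_pos hη)] with x h1 h2
  have h3 := (abs_le.1 h2).1
  have h4 : ⟪gradient φ y, x - y⟫ = fderiv ℝ φ y (x - y) := by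
    rw [← toDual_gradient]
    rfl
  rw [h4]
  linarith

theorem ComparisonBelow.superPair {n : ℕ} (hn : 1 ≤ n) {U : Set (EuclideanSpace ℝ (Fin n))}
    (hU : IsOpen U) {u v : EuclideanSpace ℝ (Fin n) → ℝ} (hv : ContinuousOn v U)
    (h : ComparisonBelow U u v) : SuperPair U u v := by
  intro φ hφ y hy hmin
  have hvy : ContinuousAt v y := hv.continuousAt (hU.mem_nhds hy)
  set T := fderiv ℝ (fderiv ℝ φ) y with hT
  suffices laplInfMinus φ y ≤ u y - v y by linarith
  refine le_of_forall_pos_le_add fun η hη => ?_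
  have htaylor := eventually_taylor_le_of_isLocalMinOn hU hy hφ hmin hη
  rw [← hT] at htaylor
  unfold laplInfMinus
  simp only [secondDeriv_eq_fderiv, ← hT]
  split_ifs with hgrad
  · set S := {t : ℝ | ∃ w : EuclideanSpace ℝ (Fin n), ‖w‖ = 1 ∧ t = T w w} with hS
    have hbdd : BddBelow S := by
      refine ⟨-‖T‖, ?_⟩
      rintro t ⟨w, hw, rfl⟩
      have : |T w w| ≤ ‖T‖ := by simpa [hw] using T.le_opNorm₂ w w
      exact (abs_le.1 this).1
    have hlow : ∀ w, sInf S * ‖w‖ ^ 2 ≤ T w w := by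
      intro w
      rcases eq_or_ne w 0 with rfl | hw
      · simp
      · have hw0 : 0 < ‖w‖ := norm_pos_iff.2 hw
        have := csInf_le hbdd (show T (‖w‖⁻¹ • w) (‖w‖⁻¹ • w) ∈ S from
          ⟨_, by rw [norm_smul, norm_inv, norm_norm, inv_mul_cancel₀ hw0.ne'], rfl⟩)
        simp only [map_smul, smul_apply, smul_eq_mul] at this
        calc sInf S * ‖w‖ ^ 2 ≤ ‖w‖⁻¹ * (‖w‖⁻¹ * T w w) * ‖w‖ ^ 2 := by gcongr
          _ = T w w := by field_simp
    have he : ‖(EuclideanSpace.single (⟨0, hn⟩ : Fin n) (1 : ℝ))‖ = 1 := by simp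
    have := h.le_sub_of_paraboloid hU hy hvy he (l := sInf S - η) (by
      filter_upwards [htaylor] with x hx
      rw [hgrad, inner_zero_left] at hx
      have := hlow (x - y)
      linarith)
    linarith
  · have hp : 0 < ‖gradient φ y‖ := norm_pos_iff.2 hgrad
    set p := ‖gradient φ y‖ with hpdef
    set e := p⁻¹ • gradient φ y with hedef
    have he : ‖e‖ = 1 := by
      rw [hedef, norm_smul, norm_inv, Real.norm_of_nonneg hp.le, ← hpdef,
        inv_mul_cancel₀ hp.ne']
    have hpe : gradient φ y = p • e := by
      rw [hedef, smul_smul, mul_inv_cancel₀ hp.ne', one_smul]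
    set B := T - η • (isBoundedBilinearMap_inner (𝕜 := ℝ)
      (E := EuclideanSpace ℝ (Fin n))).toContinuousLinearMap
    have hBw : ∀ w, B w w = T w w - η * ‖w‖ ^ 2 := fun w => by
      rw [← real_inner_self_eq_norm_sq]
      rfl
    have := h.le_sub_of_gradient hU hy hvy he hp (B := B) (by
      filter_upwards [htaylor] with x hx
      rw [hpe, inner_smul_left, conj_trivial] at hx
      rwa [hBw])
    have hTe : T (gradient φ y) (gradient φ y) / p ^ 2 = T e e := by
      rw [hpe]
      simp only [map_smul, smul_apply, smul_eq_mul]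
      field_simp
    rw [hTe]
    rw [hBw, he] at this
    linarith

/-- Characterization of supersolutions (Theorem 4.1, supersolution part). -/
theorem supersolution_iff_comparisonBelow {n : ℕ} (hn : 1 ≤ n)
    {U : Set (EuclideanSpace ℝ (Fin n))} (hUo : IsOpen U) (hUb : Bornology.IsBounded U)
    {u₁ u₂ : EuclideanSpace ℝ (Fin n) → ℝ}
    (hu₁ : ContinuousOn u₁ (closure U)) (hu₂ : ContinuousOn u₂ (closure U)) :
    IsSupersolution U u₁ u₂ ↔ ComparisonBelow U u₁ u₂ := by
  have hc₁ : ContinuousOn u₁ U := hu₁.mono subset_closure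
  have hc₂ : ContinuousOn u₂ U := hu₂.mono subset_closure
  exact ⟨fun h => h.comparisonBelow hUo hc₁ hc₂, fun h => ⟨hc₁.lowerSemicontinuousOn,
    hc₂.lowerSemicontinuousOn, h.superPair hn hUo hc₂, h.swap.superPair hn hUo hc₁⟩⟩
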